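/- arXiv:2509.08487 — 3 statements merged into one kernel-verified Lean document; each statement's English description precedes it below -/
import Mathlib

section
/- Let (Ω, 𝓕, ℙ) be a probability space and let F₁, F₂, G₁, G₂ : Ω → ℝ be measurable functions with |Fᵢ(ω)| ≤ 1 and |Gⱼ(ω)| ≤ 1 for all ω ∈ Ω and i, j ∈ {1,2}. Then |𝔼[F₁G₁ − F₁G₂ + F₂G₁ + F₂G₂]| ≤ 2, where 𝔼 denotes integration against ℙ. -/
open MeasureTheory

theorem abs_chsh_le_two {a b c d : ℝ} (ha : |a| ≤ 1) (hb : |b| ≤ 1) (hc : |c| ≤ 1)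
    (hd : |d| ≤ 1) : |a * c - a * d + b * c + b * d| ≤ 2 :=
  calc |a * c - a * d + b * c + b * d| = |a * (c - d) + b * (c + d)| := by ring_nf
    _ ≤ |a| * |c - d| + |b| * |c + d| := by
      simpa only [abs_mul] using abs_add_le (a * (c - d)) (b * (c + d))
    _ ≤ |c - d| + |c + d| :=
      add_le_add (mul_le_of_le_one_left (abs_nonneg _) ha)
        (mul_le_of_le_one_left (abs_nonneg _) hb)
    _ ≤ 2 := by
      rw [abs_le] at hc hd
      rcases abs_cases (c - d) with h | h <;> rcases abs_cases (c + d) with h' | h' <;> linarith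

theorem chsh_expectation_bound
    {Ω : Type*} [MeasurableSpace Ω] (P : Measure Ω) [IsProbabilityMeasure P]
    (F₁ F₂ G₁ G₂ : Ω → ℝ)
    (hF₁ : Measurable F₁) (hF₂ : Measurable F₂)
    (hG₁ : Measurable G₁) (hG₂ : Measurable G₂)
    (hbF₁ : ∀ ω, |F₁ ω| ≤ 1) (hbF₂ : ∀ ω, |F₂ ω| ≤ 1)
    (hbG₁ : ∀ ω, |G₁ ω| ≤ 1) (hbG₂ : ∀ ω, |G₂ ω| ≤ 1) :
    |∫ ω, (F₁ ω * G₁ ω - F₁ ω * G₂ ω + F₂ ω * G₁ ω + F₂ ω * G₂ ω) ∂P| ≤ 2 := by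
  have hbound : ∀ᵐ ω ∂P, ‖F₁ ω * G₁ ω - F₁ ω * G₂ ω + F₂ ω * G₁ ω + F₂ ω * G₂ ω‖ ≤ 2 :=
    .of_forall fun ω => abs_chsh_le_two (hbF₁ ω) (hbF₂ ω) (hbG₁ ω) (hbG₂ ω)
  simpa using norm_integral_le_of_norm_le_const hbound
end

section
/- For all angles a, b ∈ ℝ and all outcomes p, q ∈ {−1,1}, the inner product ⟨P^{(a,b)}(p,q) h_Bell, h_Bell⟩ equals (1/2)·cos²(a−b) if p = q and equals (1/2)·sin²(a−b) if p ≠ q. -/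
open Matrix
open Kronecker

noncomputable def Rot (γ : ℝ) : Matrix (Fin 2) (Fin 2) ℂ :=
  !![(Real.cos γ : ℂ), -(Real.sin γ : ℂ); (Real.sin γ : ℂ), (Real.cos γ : ℂ)]

noncomputable def P3 (p : ℤ) : Matrix (Fin 2) (Fin 2) ℂ :=
  if p = 1 then !![1, 0; 0, 0] else !![0, 0; 0, 1]

noncomputable def PVM (a b : ℝ) (p q : ℤ) :
    Matrix (Fin 2 × Fin 2) (Fin 2 × Fin 2) ℂ :=
  ((Rot a)ᵀ * P3 p * Rot a) ⊗ₖ ((Rot b)ᵀ * P3 q * Rot b)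

noncomputable def hBell : Fin 2 × Fin 2 → ℂ :=
  fun x => if x.1 = x.2 then ((1 / Real.sqrt 2 : ℝ) : ℂ) else 0

theorem sum_star_hBell_mul_kronecker_mulVec_hBell (A B : Matrix (Fin 2) (Fin 2) ℂ) :
    ∑ x : Fin 2 × Fin 2, star (hBell x) * ((A ⊗ₖ B).mulVec hBell x) =
      1 / 2 * ∑ i, ∑ j, A i j * B i j := by
  have h : ((Real.sqrt 2 : ℝ) : ℂ)⁻¹ * ((Real.sqrt 2 : ℝ) : ℂ)⁻¹ = 1 / 2 := by
    rw [← mul_inv, ← Complex.ofReal_mul, Real.mul_self_sqrt zero_le_two]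
    norm_num
  simp [Fintype.sum_prod_type, Fin.sum_univ_two, Matrix.mulVec, dotProduct, hBell]
  linear_combination (A 0 0 * B 0 0 + A 0 1 * B 0 1 + A 1 0 * B 1 0 + A 1 1 * B 1 1) * h

theorem bell_state_joint_statistics (a b : ℝ) (p q : ℤ)
    (hp : p = 1 ∨ p = -1) (hq : q = 1 ∨ q = -1) :
    ∑ x : Fin 2 × Fin 2, star (hBell x) * ((PVM a b p q).mulVec hBell x) =
      if p = q then ((1 / 2) * Real.cos (a - b) ^ 2 : ℝ)
      else ((1 / 2) * Real.sin (a - b) ^ 2 : ℝ) := by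
  rw [PVM, sum_star_hBell_mul_kronecker_mulVec_hBell]
  rcases hp with rfl | rfl <;> rcases hq with rfl | rfl <;>
    simp [Rot, P3, Matrix.mul_apply, Fin.sum_univ_two, Real.cos_sub, Real.sin_sub] <;> ring
end

section
/- For every angle a ∈ ℝ and every outcome p ∈ {−1,1}, ⟨((R_aᵀ P₃(p) R_a) ⊗ I₂) h_Bell, h_Bell⟩ = 1/2, and for every angle b ∈ ℝ and every outcome q ∈ {−1,1}, ⟨(I₂ ⊗ (R_bᵀ P₃(q) R_b)) h_Bell, h_Bell⟩ = 1/2. In particular, the distribution of each local measurement on the Bell state is uniform and independent of the other side's polariser setting. -/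
open Matrix
open Kronecker

lemma one_div_sqrt_two_mul_self :
    ((1 / Real.sqrt 2 : ℝ) : ℂ) * ((1 / Real.sqrt 2 : ℝ) : ℂ) = 1 / 2 := by
  rw [← Complex.ofReal_mul, div_mul_div_comm, Real.mul_self_sqrt zero_le_two]
  norm_num

lemma sum_star_hBell_mul_kronecker_one (M : Matrix (Fin 2) (Fin 2) ℂ) :
    ∑ x : Fin 2 × Fin 2, star (hBell x) *
      ((M ⊗ₖ (1 : Matrix (Fin 2) (Fin 2) ℂ)).mulVec hBell x) = 1 / 2 * M.trace := by
  rw [← one_div_sqrt_two_mul_self]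
  simp only [Fintype.sum_prod_type, Fin.sum_univ_two, mulVec, dotProduct, kroneckerMap_apply,
    hBell, trace_fin_two, one_apply, Complex.star_def]
  simp [-one_div, -Complex.ofReal_div, Complex.conj_ofReal]
  ring

lemma sum_star_hBell_mul_one_kronecker (M : Matrix (Fin 2) (Fin 2) ℂ) :
    ∑ x : Fin 2 × Fin 2, star (hBell x) *
      (((1 : Matrix (Fin 2) (Fin 2) ℂ) ⊗ₖ M).mulVec hBell x) = 1 / 2 * M.trace := by
  rw [← one_div_sqrt_two_mul_self]
  simp only [Fintype.sum_prod_type, Fin.sum_univ_two, mulVec, dotProduct, kroneckerMap_apply,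
    hBell, trace_fin_two, one_apply, Complex.star_def]
  simp [-one_div, -Complex.ofReal_div, Complex.conj_ofReal]
  ring

lemma Rot_mul_transpose (γ : ℝ) : Rot γ * (Rot γ)ᵀ = 1 := by
  have h := Complex.sin_sq_add_cos_sq (γ : ℂ)
  ext i j
  fin_cases i <;> fin_cases j <;> simp [Rot, mul_apply, Fin.sum_univ_two] <;> grind

lemma trace_P3 (p : ℤ) : (P3 p).trace = 1 := by
  unfold P3
  split_ifs <;> simp [trace_fin_two]

lemma trace_transpose_Rot_mul_P3_mul_Rot (γ : ℝ) (p : ℤ) :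
    ((Rot γ)ᵀ * P3 p * Rot γ).trace = 1 := by
  rw [trace_mul_comm, ← Matrix.mul_assoc, Rot_mul_transpose, Matrix.one_mul, trace_P3]

theorem bell_state_local_statistics_uniform :
    (∀ (a : ℝ) (p : ℤ), p = 1 ∨ p = -1 →
      ∑ x : Fin 2 × Fin 2, star (hBell x) *
        ((((Rot a)ᵀ * P3 p * Rot a) ⊗ₖ (1 : Matrix (Fin 2) (Fin 2) ℂ)).mulVec hBell x)
        = (1 / 2 : ℂ)) ∧
    (∀ (b : ℝ) (q : ℤ), q = 1 ∨ q = -1 →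
      ∑ x : Fin 2 × Fin 2, star (hBell x) *
        (((1 : Matrix (Fin 2) (Fin 2) ℂ) ⊗ₖ ((Rot b)ᵀ * P3 q * Rot b)).mulVec hBell x)
        = (1 / 2 : ℂ)) := by
  refine ⟨fun a p _ => ?_, fun b q _ => ?_⟩
  · rw [sum_star_hBell_mul_kronecker_one, trace_transpose_Rot_mul_P3_mul_Rot, mul_one]
  · rw [sum_star_hBell_mul_one_kronecker, trace_transpose_Rot_mul_P3_mul_Rot, mul_one]
end
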